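/- arXiv:2207.11085 — 2 statements merged into one kernel-verified Lean document; each statement's English description precedes it below -/
import Mathlib

section
/- Let V be a finite-dimensional real inner product space and ω an alternating bilinear form on V. Let A : V → V be the linear map determined by ω(u,v) = ⟨A u, v⟩ for all u, v ∈ V, and assume A is bijective. Let B : V → V be a positive self-adjoint linear operator with B ∘ B = -(A ∘ A), and let J = A⁻¹ ∘ B. If h : V → V is a linear isometric equivalence satisfying ω(h u, h v) = ω(u, v) for all u, v ∈ V, then h ∘ J = J ∘ h, and the bilinear form g_J(u,v) := ω(J u, v) is h-invariant, i.e. ω(J (h u), h v) = ω(J u, v) for all u, v ∈ V. -/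
open RealInnerProductSpace

/-- A positive operator acts on an eigenvector of its square by the nonnegative square root of the
eigenvalue. -/
theorem LinearMap.IsPositive.apply_eq_smul_of_apply_apply_eq
    {V : Type*} [NormedAddCommGroup V] [InnerProductSpace ℝ V] {C : V →ₗ[ℝ] V}
    (hC : C.IsPositive) {b : ℝ} (hb : 0 ≤ b) {v : V} (hv : C (C v) = (b * b) • v) :
    C v = b • v := by
  rcases hb.eq_or_lt with rfl | hb
  · have h0 : ⟪C v, C v⟫ = 0 := by
      rw [← hC.isSymmetric (C v) v, hv]
      simp
    simpa using h0
  · have hw : C (C v - b • v) = -(b • (C v - b • v)) := by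
      rw [map_sub, map_smul, hv]
      module
    have hpos := hC.inner_nonneg_left (C v - b • v)
    rw [hw, inner_neg_left, real_inner_smul_left] at hpos
    have h0 : ⟪C v - b • v, C v - b • v⟫ = 0 :=
      le_antisymm (by nlinarith) real_inner_self_nonneg
    exact sub_eq_zero.mp (inner_self_eq_zero.mp h0)

/-- Positive square roots are unique. -/
theorem LinearMap.IsPositive.eq_of_comp_self_eq
    {V : Type*} [NormedAddCommGroup V] [InnerProductSpace ℝ V] [FiniteDimensional ℝ V]
    {B C : V →ₗ[ℝ] V} (hB : B.IsPositive) (hC : C.IsPositive)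
    (hBC : C ∘ₗ C = B ∘ₗ B) : C = B := by
  refine (hB.isSymmetric.eigenvectorBasis rfl).toBasis.ext fun i ↦ ?_
  have hBv := hB.isSymmetric.apply_eigenvectorBasis rfl i
  have hb : 0 ≤ hB.isSymmetric.eigenvalues rfl i := hB.nonneg_eigenvalues rfl i
  rw [OrthonormalBasis.coe_toBasis, hBv]
  refine hC.apply_eq_smul_of_apply_apply_eq hb ?_
  rw [← LinearMap.comp_apply, hBC, LinearMap.comp_apply, hBv, map_smul, hBv, smul_smul]
  rfl

/-- Linear-algebraic content of Lemma 4.1: the almost complex structure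
`J = A⁻¹ ∘ B` (with `B = √(-A²)`) commutes with every symplectic isometry `h`,
and the metric `g_J(u,v) = ω(J u, v)` is `h`-invariant. -/
theorem maslov_stmt0
    {V : Type*} [NormedAddCommGroup V] [InnerProductSpace ℝ V]
    [FiniteDimensional ℝ V]
    (ω : V →ₗ[ℝ] V →ₗ[ℝ] ℝ) (hω_alt : ∀ v, ω v v = 0)
    (A : V →ₗ[ℝ] V) (hA : ∀ u v, ω u v = ⟪A u, v⟫)
    (hA_bij : Function.Bijective A)
    (B : V →ₗ[ℝ] V)
    (hB_sa : ∀ u v, ⟪B u, v⟫ = ⟪u, B v⟫)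
    (hB_pos : ∀ v, 0 ≤ ⟪B v, v⟫)
    (hB_sq : ∀ v, B (B v) = -(A (A v)))
    (J : V →ₗ[ℝ] V) (hJ : ∀ v, A (J v) = B v)
    (h : V ≃ₗᵢ[ℝ] V) (hh : ∀ u v, ω (h u) (h v) = ω u v) :
    (∀ v, h (J v) = J (h v)) ∧ (∀ u v, ω (J (h u)) (h v) = ω (J u) v) := by
  have hAh : ∀ u, A (h u) = h (A u) := fun u ↦ by
    refine ext_inner_right ℝ fun v ↦ ?_
    obtain ⟨w, rfl⟩ := h.surjective v
    rw [← hA, hh, hA, h.inner_map_map]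
  have hB : B.IsPositive := ⟨hB_sa, hB_pos⟩
  have hC : (h.toLinearMap ∘ₗ B ∘ₗ h.symm.toLinearMap).IsPositive :=
    (LinearMap.isPositive_linearIsometryEquiv_conj_iff h).mpr hB
  have hCB : h.toLinearMap ∘ₗ B ∘ₗ h.symm.toLinearMap = B := by
    refine hB.eq_of_comp_self_eq hC (LinearMap.ext fun v ↦ ?_)
    obtain ⟨w, rfl⟩ := h.surjective v
    simp [hB_sq, hAh]
  have hBh : ∀ v, h (B v) = B (h v) := fun v ↦ by
    simpa using LinearMap.congr_fun hCB (h v)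
  have hJh : ∀ v, h (J v) = J (h v) := fun v ↦
    hA_bij.injective (by rw [hAh, hJ, hJ, hBh])
  exact ⟨hJh, fun u v ↦ by rw [← hJh, hh]⟩
end

section
/- Let F be a nonempty type carrying a group action of the circle group Circle that is free and transitive, and an action of a group G on F that commutes with the Circle action. Then there exists a unique group homomorphism φ : G → Circle such that g • w = φ(g) • w for every g ∈ G and every w ∈ F; moreover, the kernel of φ equals the stabilizer subgroup of w in G for every w ∈ F (in particular, all points of F have the same stabilizer in G). -/
/-- Fiberwise content of Proposition 5.1: if the circle acts freely and
transitively on a nonempty `F` and a group `G` acts on `F` commuting with the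
circle action, then there is a unique homomorphism `φ : G → Circle` with
`g • w = φ g • w` for all `g, w`, and its kernel is the stabilizer of every
point of `F`. -/
theorem maslov_stmt4
    {G F : Type*} [Group G] [Nonempty F]
    [MulAction Circle F] [MulAction G F]
    (hfree : ∀ (z : Circle) (w : F), z • w = w → z = 1)
    (htrans : ∀ w w' : F, ∃ z : Circle, z • w = w')
    (hcomm : ∀ (g : G) (z : Circle) (w : F), g • (z • w) = z • (g • w)) :
    ∃ φ : G →* Circle,
      (∀ (g : G) (w : F), g • w = φ g • w) ∧
      (∀ ψ : G →* Circle, (∀ (g : G) (w : F), g • w = ψ g • w) → ψ = φ) ∧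
      (∀ w : F, φ.ker = MulAction.stabilizer G w) := by
  have hinj : ∀ {a b : Circle} {w : F}, a • w = b • w → a = b := fun {a b w} h ↦
    (inv_mul_eq_one.mp (hfree (b⁻¹ * a) w (by rw [mul_smul, h, inv_smul_smul]))).symm
  obtain ⟨w₀⟩ := ‹Nonempty F›
  choose f hf using fun g : G ↦ htrans w₀ (g • w₀)
  have hsmul : ∀ (g : G) (w : F), g • w = f g • w := by
    intro g w
    obtain ⟨z, rfl⟩ := htrans w₀ w
    rw [hcomm, ← hf g, smul_smul, smul_smul, mul_comm]
  refine ⟨MonoidHom.mk' f fun g h ↦ hinj (w := w₀) ?_, hsmul,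
    fun ψ hψ ↦ MonoidHom.ext fun g ↦ hinj ((hψ g w₀).symm.trans (hsmul g w₀)), fun w ↦ ?_⟩
  · rw [← hsmul, mul_smul, mul_smul, ← hsmul h, ← hsmul g]
  · ext g
    rw [MonoidHom.mem_ker, MulAction.mem_stabilizer_iff, hsmul]
    exact ⟨fun h ↦ (congrArg (· • w) h).trans (one_smul Circle w), hfree (f g) w⟩
end
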